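/- arXiv:1304.5611 — 2 statements merged into one kernel-verified Lean document; each statement's English description precedes it below -/
import Mathlib

section
/- Let N ≥ 1, let ψ : Fin N → ℝ be antitone (i.e., the values ψ(0) ≥ ψ(1) ≥ … ≥ ψ(N−1) are sorted in descending order), let u : Fin N → ℝ³, let c > 0, and let v ∈ ℝ³. Define a sequence φ₀, φ₁, …, φ_N by φ₀ = max_{I} ψ(I), and φ_{I+1} = ψ(I) if ‖v − u(I)‖ ≤ c·ψ(I), and φ_{I+1} = φ_I otherwise. Then the final value satisfies φ_N = min( min{ ψ(I) : I ∈ Fin N, ‖v − u(I)‖ ≤ c·ψ(I) }, max_{I} ψ(I) ), where the inner minimum over the (possibly empty) set is taken to be max_I ψ(I) when no index I satisfies ‖v − u(I)‖ ≤ c·ψ(I). -/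
/-- A register that is overwritten by `f I` at each step `I` satisfying `p` holds, after `n` steps,
the value at the last such `I < n`, or its initial value if there is none. -/
theorem overwrite_eq_last {α : Type*} {N : ℕ} (p : Fin N → Prop) [DecidablePred p]
    (f : Fin N → α) (φ : ℕ → α)
    (hφ : ∀ I : Fin N, φ ((I : ℕ) + 1) = if p I then f I else φ (I : ℕ)) (n : ℕ) (hn : n ≤ N) :
    ((∀ I : Fin N, (I : ℕ) < n → ¬ p I) ∧ φ n = φ 0) ∨
      ∃ I : Fin N, p I ∧ φ n = f I ∧ ∀ J : Fin N, (J : ℕ) < n → p J → J ≤ I := by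
  induction n with
  | zero => exact Or.inl ⟨fun I hI => absurd hI (Nat.not_lt_zero _), rfl⟩
  | succ n ih =>
    have hstep := hφ ⟨n, hn⟩
    by_cases hp : p ⟨n, hn⟩
    · rw [if_pos hp] at hstep
      exact Or.inr ⟨⟨n, hn⟩, hp, hstep, fun J hJ _ => Nat.le_of_lt_succ hJ⟩
    · rw [if_neg hp] at hstep
      have hlt : ∀ J : Fin N, (J : ℕ) < n + 1 → p J → (J : ℕ) < n := fun J hJ hpJ =>
        lt_of_le_of_ne (Nat.le_of_lt_succ hJ) fun h => hp (by
          have : J = ⟨n, hn⟩ := Fin.ext h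
          exact this ▸ hpJ)
      rcases ih (Nat.le_of_succ_le hn) with ⟨hnone, h0⟩ | ⟨I, hI, hval, hlast⟩
      · exact Or.inl ⟨fun J hJ hpJ => hnone J (hlt J hJ hpJ) hpJ, hstep.trans h0⟩
      · exact Or.inr ⟨I, hI, hstep.trans hval, fun J hJ hpJ => hlast J (hlt J hJ hpJ) hpJ⟩


/-- Algorithm 1 of the paper: starting from `φ 0 = max ψ` and overwriting
`φ (I+1) = ψ I` whenever `‖v − u I‖ ≤ c ψ I` (the values `ψ I` being sorted in
descending order), the final value `φ N` is the minimum of `ψ I` over all indices `I`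
with `‖v − u I‖ ≤ c ψ I` (capped by `max ψ`, and equal to `max ψ` if no such index
exists). -/
theorem support_function_algorithm (N : ℕ) (hN : 1 ≤ N) (ψ : Fin N → ℝ)
    (hψ : Antitone ψ) (u : Fin N → EuclideanSpace ℝ (Fin 3)) (c : ℝ) (hc : 0 < c)
    (v : EuclideanSpace ℝ (Fin 3)) (φ : ℕ → ℝ)
    (hφ0 : φ 0 = Finset.univ.sup'
      (Finset.univ_nonempty_iff.mpr (Fin.pos_iff_nonempty.mp hN)) ψ)
    (hφ : ∀ I : Fin N,
      φ ((I : ℕ) + 1) = if ‖v - u I‖ ≤ c * ψ I then ψ I else φ (I : ℕ)) :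
    φ N = if hS : (Finset.univ.filter fun I : Fin N => ‖v - u I‖ ≤ c * ψ I).Nonempty
      then min ((Finset.univ.filter fun I : Fin N => ‖v - u I‖ ≤ c * ψ I).inf' hS ψ)
        (Finset.univ.sup'
          (Finset.univ_nonempty_iff.mpr (Fin.pos_iff_nonempty.mp hN)) ψ)
      else Finset.univ.sup'
        (Finset.univ_nonempty_iff.mpr (Fin.pos_iff_nonempty.mp hN)) ψ := by
  rcases overwrite_eq_last (fun I => ‖v - u I‖ ≤ c * ψ I) ψ φ hφ N le_rfl with
    ⟨hnone, h0⟩ | ⟨I, hI, hval, hlast⟩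
  · rw [dif_neg, h0, hφ0]
    rintro ⟨I, hI⟩
    exact hnone I I.isLt (Finset.mem_filter.mp hI).2
  · have hmem : I ∈ Finset.univ.filter fun I : Fin N => ‖v - u I‖ ≤ c * ψ I :=
      Finset.mem_filter.mpr ⟨Finset.mem_univ I, hI⟩
    have hinf : (Finset.univ.filter fun I : Fin N => ‖v - u I‖ ≤ c * ψ I).inf' ⟨I, hmem⟩ ψ = ψ I :=
      le_antisymm (Finset.inf'_le ψ hmem) <| Finset.le_inf' _ _ fun J hJ =>
        hψ (hlast J J.isLt (Finset.mem_filter.mp hJ).2)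
    rw [dif_pos ⟨I, hmem⟩, hval, hinf, min_eq_left (Finset.le_sup' ψ (Finset.mem_univ I))]
end

section
/- Let v_0, …, v_Q ∈ ℝ³ be discrete velocities with positive quadrature weights ω_0, …, ω_Q > 0, and let m(v) = (1, v₁, v₂, v₃, ½|v|²) ∈ ℝ⁵. If the vectors m(v_0), …, m(v_Q) span ℝ⁵, then the map F : ℝ⁵ → ℝ⁵ defined by F(α) = Σ_{q=0}^{Q} m(v_q) · exp(⟨α, m(v_q)⟩) · ω_q is injective; in particular, for any moment vector U ∈ ℝ⁵ the nonlinear system F(α) = U has at most one solution α. -/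
open scoped RealInnerProductSpace

/-- The vector of collisional invariants `m(v) = (1, v₁, v₂, v₃, ½|v|²) ∈ ℝ⁵`. -/
noncomputable def mvec (v : EuclideanSpace ℝ (Fin 3)) : EuclideanSpace ℝ (Fin 5) :=
  (WithLp.equiv 2 (Fin 5 → ℝ)).symm ![1, v 0, v 1, v 2, (1 / 2 : ℝ) * ‖v‖ ^ 2]

/-- A finite sum of vectors `m q` with positive weights times `exp ⟪α, m q⟫` determines `α`
whenever the `m q` span the space. -/
theorem sum_exp_inner_smul_injective {ι E : Type*} [Fintype ι] [NormedAddCommGroup E]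
    [InnerProductSpace ℝ E] {m : ι → E} {w : ι → ℝ} (hw : ∀ q, 0 < w q)
    (hspan : Submodule.span ℝ (Set.range m) = ⊤) :
    Function.Injective fun α : E => ∑ q, (Real.exp ⟪α, m q⟫ * w q) • m q := by
  intro α β h
  have hmono (x y : ℝ) : 0 ≤ (x - y) * (Real.exp x - Real.exp y) := by
    rcases le_total x y with hxy | hxy
    · exact mul_nonneg_of_nonpos_of_nonpos (sub_nonpos.2 hxy)
        (sub_nonpos.2 (Real.exp_le_exp.2 hxy))
    · exact mul_nonneg (sub_nonneg.2 hxy) (sub_nonneg.2 (Real.exp_le_exp.2 hxy))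
  have hsum : ∑ q, w q * ((⟪α, m q⟫ - ⟪β, m q⟫) *
      (Real.exp ⟪α, m q⟫ - Real.exp ⟪β, m q⟫)) = 0 := by
    have h' := congrArg (fun x => ⟪α - β, x⟫) (sub_eq_zero.2 h)
    simp only [← Finset.sum_sub_distrib, ← sub_smul, inner_sum, inner_smul_right, inner_sub_left,
      inner_zero_right] at h'
    rw [← h']
    exact Finset.sum_congr rfl fun q _ => by ring
  have hinner (q : ι) : ⟪α, m q⟫ = ⟪β, m q⟫ := by
    have hq := (Finset.sum_eq_zero_iff_of_nonneg
      fun q _ => mul_nonneg (hw q).le (hmono _ _)).1 hsum q (Finset.mem_univ q)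
    rcases mul_eq_zero.1 ((mul_eq_zero.1 hq).resolve_left (hw q).ne') with hq | hq
    · exact sub_eq_zero.1 hq
    · exact Real.exp_injective (sub_eq_zero.1 hq)
  have hext : innerSL ℝ α = innerSL ℝ β :=
    ContinuousLinearMap.coe_injective <| LinearMap.ext_on_range hspan fun q => by
      simpa using hinner q
  exact ext_inner_right ℝ fun x => by simpa using congrArg (fun f => f x) hext

/-- If the vectors `m(v_q)` span `ℝ⁵`, then the map
`F(α) = Σ_q m(v_q) exp(⟨α, m(v_q)⟩) ω_q` is injective; in particular the discrete
Maxwellian moment system `F(α) = U` has at most one solution. -/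
theorem discrete_maxwellian_uniqueness (Q : ℕ)
    (v : Fin (Q + 1) → EuclideanSpace ℝ (Fin 3))
    (ω : Fin (Q + 1) → ℝ) (hω : ∀ q, 0 < ω q)
    (hspan : Submodule.span ℝ (Set.range fun q => mvec (v q)) = ⊤) :
    Function.Injective (fun α : EuclideanSpace ℝ (Fin 5) =>
      ∑ q, (Real.exp ⟪α, mvec (v q)⟫ * ω q) • mvec (v q)) ∧
    ∀ (U α β : EuclideanSpace ℝ (Fin 5)),
      (∑ q, (Real.exp ⟪α, mvec (v q)⟫ * ω q) • mvec (v q)) = U →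
      (∑ q, (Real.exp ⟪β, mvec (v q)⟫ * ω q) • mvec (v q)) = U →
      α = β := by
  have hinj := sum_exp_inner_smul_injective hω hspan
  exact ⟨hinj, fun _ _ _ hα hβ => hinj (hα.trans hβ.symm)⟩
end
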